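/- Assume (H1)–(H7). Then any two solutions x and x̂ of system (1) with bounded initial conditions (possibly at different initial times t₀, t̂₀ ≥ 0) satisfy lim_{t→+∞} |x(t) − x̂(t)| = 0, where |·| is the max norm on ℝ^n. -/

import Mathlib

open MeasureTheory Filter

/-- The data of the Cohen--Grossberg system (1), with `n+1` neurons and `P+1` delay blocks. -/
structure CGData (n P : ℕ) where
  a : Fin (n+1) → ℝ → ℝ → ℝ
  b : Fin (n+1) → ℝ → ℝ → ℝ
  c : Fin (n+1) → Fin (n+1) → Fin (n+1) → Fin (P+1) → ℝ → ℝ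
  d : Fin (n+1) → Fin (n+1) → Fin (n+1) → Fin (P+1) → ℝ → ℝ
  I : Fin (n+1) → ℝ → ℝ
  τ : Fin (n+1) → Fin (n+1) → Fin (P+1) → ℝ → ℝ
  σ : Fin (n+1) → Fin (n+1) → Fin (P+1) → ℝ → ℝ
  F : Fin (n+1) → ℝ → ℝ → ℝ
  h : Fin (n+1) → Fin (n+1) → Fin (n+1) → Fin (P+1) → ℝ → ℝ → ℝ
  f : Fin (n+1) → Fin (n+1) → Fin (n+1) → Fin (P+1) → ℝ → ℝ → ℝ
  g : Fin (n+1) → Fin (n+1) → Fin (P+1) → ℝ → ℝ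
  G : Fin (n+1) → Fin (n+1) → Fin (P+1) → ℝ → ℝ
  η : Fin (n+1) → Fin (n+1) → Fin (P+1) → Measure ℝ
  ρ : Fin (n+1) → Fin (n+1) → Fin (P+1) → Measure ℝ

namespace CGData

variable {n P : ℕ}

/-- `U_i(t,x)`. -/
noncomputable def U (S : CGData n P) (x : Fin (n+1) → ℝ → ℝ) (i : Fin (n+1)) (t : ℝ) : ℝ :=
  ∑ p : Fin (P+1), ∑ j : Fin (n+1), ∑ l : Fin (n+1),
    S.c i j l p t * S.h i j l p (x j (t - S.τ i j p t)) (x l (t - S.σ i l p t))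

/-- `V_i(t,x)`. -/
noncomputable def V (S : CGData n P) (x : Fin (n+1) → ℝ → ℝ) (i : Fin (n+1)) (t : ℝ) : ℝ :=
  ∑ p : Fin (P+1), ∑ j : Fin (n+1), ∑ l : Fin (n+1),
    S.d i j l p t * S.f i j l p
      (∫ s in Set.Iic (0:ℝ), S.g i j p (x j (t + s)) ∂(S.η i j p))
      (∫ s in Set.Iic (0:ℝ), S.G i l p (x l (t + s)) ∂(S.ρ i l p))

/-- Right-hand side of system (1). -/
noncomputable def rhs (S : CGData n P) (x : Fin (n+1) → ℝ → ℝ) (i : Fin (n+1)) (t : ℝ) : ℝ :=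
  S.a i t (x i t) * (-(S.b i t (x i t)) + S.F i (S.U x i t) (S.V x i t) + S.I i t)

/-- Standing regularity assumptions on the data (continuity, positivity of `a`,
nonnegativity of the delays, probability measures supported on `(-∞,0]`). -/
def Regular (S : CGData n P) : Prop :=
  (∀ i, ContinuousOn (fun q : ℝ × ℝ => S.a i q.1 q.2) (Set.Ici 0 ×ˢ Set.univ)) ∧
  (∀ i, ∀ t ≥ (0:ℝ), ∀ v, 0 < S.a i t v) ∧
  (∀ i, ContinuousOn (fun q : ℝ × ℝ => S.b i q.1 q.2) (Set.Ici 0 ×ˢ Set.univ)) ∧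
  (∀ i j l p, ContinuousOn (S.c i j l p) (Set.Ici 0)) ∧
  (∀ i j l p, ContinuousOn (S.d i j l p) (Set.Ici 0)) ∧
  (∀ i, ContinuousOn (S.I i) (Set.Ici 0)) ∧
  (∀ i j p, ContinuousOn (S.τ i j p) (Set.Ici 0)) ∧
  (∀ i l p, ContinuousOn (S.σ i l p) (Set.Ici 0)) ∧
  (∀ i j p, ∀ t ≥ (0:ℝ), 0 ≤ S.τ i j p t) ∧
  (∀ i l p, ∀ t ≥ (0:ℝ), 0 ≤ S.σ i l p t) ∧
  (∀ i, Continuous (fun q : ℝ × ℝ => S.F i q.1 q.2)) ∧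
  (∀ i j l p, Continuous (fun q : ℝ × ℝ => S.h i j l p q.1 q.2)) ∧
  (∀ i j l p, Continuous (fun q : ℝ × ℝ => S.f i j l p q.1 q.2)) ∧
  (∀ i j p, Continuous (S.g i j p)) ∧
  (∀ i l p, Continuous (S.G i l p)) ∧
  (∀ i j p, IsProbabilityMeasure (S.η i j p) ∧ S.η i j p (Set.Ioi 0) = 0) ∧
  (∀ i l p, IsProbabilityMeasure (S.ρ i l p) ∧ S.ρ i l p (Set.Ioi 0) = 0)

/-- A solution of (1) on `ℝ` with bounded initial condition at `t₀`. -/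
def IsSolution (S : CGData n P) (t₀ : ℝ) (x : Fin (n+1) → ℝ → ℝ) : Prop :=
  (∀ i, Continuous (x i)) ∧
  (∃ M, ∀ i, ∀ t ≤ t₀, |x i t| ≤ M) ∧
  (∀ i, ∀ t, t₀ < t → HasDerivAt (x i) (S.rhs x i t) t)

/-- Hypothesis (H1): boundedness of the coefficients. -/
def H1 (S : CGData n P) : Prop :=
  (∀ i j l p, ∃ M, ∀ t ≥ (0:ℝ), |S.c i j l p t| ≤ M) ∧
  (∀ i j l p, ∃ M, ∀ t ≥ (0:ℝ), |S.d i j l p t| ≤ M) ∧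
  (∀ i, ∃ M, ∀ t ≥ (0:ℝ), |S.I i t| ≤ M) ∧
  (∀ i, ∀ u : ℝ, ∃ M, ∀ t ≥ (0:ℝ), |S.b i t u| ≤ M)

/-- Hypothesis (H2). -/
def H2 (S : CGData n P) (aL aU : Fin (n+1) → ℝ) (A : Fin (n+1) → ℝ → ℝ) : Prop :=
  (∀ i, 0 < aL i) ∧ (∀ i, aL i ≤ aU i) ∧
  (∀ i, ∀ t ≥ (0:ℝ), ∀ v, aL i ≤ S.a i t v ∧ S.a i t v ≤ aU i) ∧
  (∀ i, ∀ v : ℝ, ∀ t ≥ (0:ℝ),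
    ∃ da, HasDerivAt (fun s => S.a i s v) da t ∧ A i t * (S.a i t v) ^ 2 ≤ da)

/-- Hypothesis (H3). -/
def H3 (S : CGData n P) (β : Fin (n+1) → ℝ → ℝ) : Prop :=
  (∀ i, ContinuousOn (β i) (Set.Ici 0)) ∧
  (∀ i, ∀ t ≥ (0:ℝ), 0 ≤ β i t) ∧
  (∀ i, ∀ t ≥ (0:ℝ), ∀ u v : ℝ, u ≠ v → β i t ≤ (S.b i t u - S.b i t v) / (u - v))

/-- Hypothesis (H4): unbounded delays eventually dominated by `t`. -/
def H4 (S : CGData n P) : Prop :=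
  (∀ i j p, Tendsto (fun t => t - S.τ i j p t) atTop atTop) ∧
  (∀ i l p, Tendsto (fun t => t - S.σ i l p t) atTop atTop)

/-- Hypothesis (H5). -/
def H5 (S : CGData n P)
    (γ1 γ2 μ1 μ2 : Fin (n+1) → Fin (n+1) → Fin (n+1) → Fin (P+1) → ℝ) : Prop :=
  (∀ i j l p, 0 < γ1 i j l p ∧ 0 < γ2 i j l p ∧ 0 < μ1 i j l p ∧ 0 < μ2 i j l p) ∧
  (∀ i j l p u1 u2 v1 v2,
    |S.h i j l p u1 u2 - S.h i j l p v1 v2| ≤ γ1 i j l p * |u1 - v1| + γ2 i j l p * |u2 - v2|) ∧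
  (∀ i j l p u1 u2 v1 v2,
    |S.f i j l p u1 u2 - S.f i j l p v1 v2| ≤ μ1 i j l p * |u1 - v1| + μ2 i j l p * |u2 - v2|)

/-- Hypothesis (H6). -/
def H6 (S : CGData n P) (ξ Ξ : Fin (n+1) → Fin (n+1) → Fin (P+1) → ℝ)
    (ζ ς : Fin (n+1) → ℝ) : Prop :=
  (∀ i j p, 0 < ξ i j p) ∧ (∀ i l p, 0 < Ξ i l p) ∧ (∀ i, 0 < ζ i ∧ 0 < ς i) ∧
  (∀ i j p u v, |S.g i j p u - S.g i j p v| ≤ ξ i j p * |u - v|) ∧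
  (∀ i l p u v, |S.G i l p u - S.G i l p v| ≤ Ξ i l p * |u - v|) ∧
  (∀ i u1 u2 v1 v2, |S.F i u1 u2 - S.F i v1 v2| ≤ ζ i * |u1 - v1| + ς i * |u2 - v2|)

/-- The expression whose `limsup` is required to be negative in hypothesis (H7). -/
noncomputable def H7expr (S : CGData n P) (aL aU : Fin (n+1) → ℝ) (A : Fin (n+1) → ℝ → ℝ)
    (β : Fin (n+1) → ℝ → ℝ)
    (γ1 γ2 μ1 μ2 : Fin (n+1) → Fin (n+1) → Fin (n+1) → Fin (P+1) → ℝ)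
    (ξ Ξ : Fin (n+1) → Fin (n+1) → Fin (P+1) → ℝ) (ζ ς : Fin (n+1) → ℝ)
    (dv : Fin (n+1) → ℝ) (i : Fin (n+1)) (t : ℝ) : ℝ :=
  -(aL i * (β i t + A i t)) +
    ∑ p : Fin (P+1), ∑ j : Fin (n+1), ∑ l : Fin (n+1),
      (ζ i * |S.c i j l p t| *
          (aU j * (dv j / dv i) * γ1 i j l p + aU l * (dv l / dv i) * γ2 i j l p)
        + ς i * |S.d i j l p t| *
          (aU j * (dv j / dv i) * ξ i j p * μ1 i j l p
            + aU l * (dv l / dv i) * Ξ i l p * μ2 i j l p))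

/-- Hypothesis (H7). -/
def H7 (S : CGData n P) (aL aU : Fin (n+1) → ℝ) (A : Fin (n+1) → ℝ → ℝ)
    (β : Fin (n+1) → ℝ → ℝ)
    (γ1 γ2 μ1 μ2 : Fin (n+1) → Fin (n+1) → Fin (n+1) → Fin (P+1) → ℝ)
    (ξ Ξ : Fin (n+1) → Fin (n+1) → Fin (P+1) → ℝ) (ζ ς : Fin (n+1) → ℝ)
    (dv : Fin (n+1) → ℝ) : Prop :=
  (∀ i, 0 < dv i) ∧
  (∀ i, limsup (fun t => S.H7expr aL aU A β γ1 γ2 μ1 μ2 ξ Ξ ζ ς dv i t) atTop < 0)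

end CGData

open Set Topology in
lemma le_max_sub_mul_of_eventually_le {w : ℝ → ℝ} {T b r δ : ℝ}
    (hw : ContinuousOn w (Icc T b))
    (h : ∀ t ∈ Ico T b, r ≤ w t → ∀ᶠ z in 𝓝[>] t, w z ≤ w t - δ * (z - t)) (hδ : 0 ≤ δ) :
    ∀ t ∈ Icc T b, w t ≤ max r (w T - δ * (t - T)) := by
  have hB : Continuous (fun t => max r (w T - δ * (t - T))) := by fun_prop
  have hclosed : IsClosed ({t | w t ≤ max r (w T - δ * (t - T))} ∩ Icc T b) := by
    rw [inter_comm]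
    exact isClosed_Icc.isClosed_le hw hB.continuousOn
  refine hclosed.Icc_subset_of_forall_exists_gt (by simp) ?_
  rintro t ⟨ht, htI⟩ y hy
  have hev : ∀ᶠ z in 𝓝[>] t, w z ≤ max r (w T - δ * (z - T)) := by
    rcases (show w t ≤ max r (w T - δ * (t - T)) from ht).lt_or_eq with hlt | heq
    · have hwt : ContinuousWithinAt w (Ioi t) t :=
        (hw t (Ico_subset_Icc_self htI)).mono_of_mem_nhdsWithin
          (mem_of_superset (Ioo_mem_nhdsGT htI.2) fun z hz => ⟨htI.1.trans hz.1.le, hz.2.le⟩)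
      exact (hwt.eventually_lt hB.continuousWithinAt hlt).mono fun z hz => hz.le
    · filter_upwards [h t htI (heq ▸ le_max_left _ _), self_mem_nhdsWithin] with z hz htz
      have hδz : 0 ≤ δ * (z - t) := mul_nonneg hδ (sub_nonneg.2 (le_of_lt htz))
      rcases max_cases r (w T - δ * (t - T)) with ⟨hm, _⟩ | ⟨hm, _⟩
      · exact le_max_of_le_left (by linarith)
      · exact le_max_of_le_right (by linarith)
  obtain ⟨z, hz, hzy⟩ := (hev.and (Ioc_mem_nhdsGT hy)).exists
  exact ⟨z, hz, hzy⟩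

open Topology in
lemma hasDerivAt_integral_of_continuous {k : ℝ → ℝ → ℝ} (hk : Continuous (Function.uncurry k))
    {x : ℝ → ℝ} {x' t : ℝ} (hx : HasDerivAt x x' t) :
    HasDerivAt (fun z => ∫ v in x t..x z, k z v) (k t (x t) * x') t := by
  have hlin : HasDerivAt (fun z => k t (x t) * (x z - x t)) (k t (x t) * x') t :=
    (hx.sub_const _).const_mul _
  have hO : (fun z => ∫ v in x t..x z, (k z v - k t (x t))) =o[𝓝 t] fun z => x z - x t := by
    rw [Asymptotics.isLittleO_iff]
    intro e he
    have hc : ∀ᶠ q : ℝ × ℝ in 𝓝 t ×ˢ 𝓝 (x t), ‖k q.1 q.2 - k t (x t)‖ < e := by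
      rw [← nhds_prod_eq]
      have h0 : ContinuousAt (fun q : ℝ × ℝ => ‖k q.1 q.2 - k t (x t)‖) (t, x t) :=
        ((hk.sub continuous_const).norm).continuousAt
      exact h0.eventually_lt continuousAt_const (by simpa using he)
    obtain ⟨p, hp, p', hp', hpp⟩ := eventually_prod_iff.1 hc
    obtain ⟨ρ, hρ, hball⟩ := Metric.eventually_nhds_iff_ball.1 hp'
    filter_upwards [hp, hx.continuousAt (Metric.ball_mem_nhds _ hρ)] with z hz hxz
    refine intervalIntegral.norm_integral_le_of_norm_le_const fun v hv => (hpp hz (hball v ?_)).le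
    exact (convex_ball (x t) ρ).ordConnected.uIcc_subset (Metric.mem_ball_self hρ) hxz
      (Set.uIoc_subset_uIcc hv)
  have hrem : HasDerivAt (fun z => ∫ v in x t..x z, (k z v - k t (x t))) 0 t := by
    rw [hasDerivAt_iff_isLittleO]
    simpa using hO.trans_isBigO hx.isBigO_sub
  have hkz : ∀ z, Continuous (k z) := fun z => hk.comp (by fun_prop : Continuous fun v => (z, v))
  have hsum := hlin.add hrem
  rw [add_zero] at hsum
  refine hsum.congr_of_eventuallyEq (Eventually.of_forall fun z => ?_)
  simp only [Pi.add_apply]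
  rw [intervalIntegral.integral_sub ((hkz z).intervalIntegrable _ _) (by simp)]
  simp
  ring

open Topology in
lemma eventually_integral_sub_lt {k : ℝ → ℝ → ℝ} (hk : Continuous (Function.uncurry k))
    {x y : ℝ → ℝ} {x' y' t m r : ℝ} (hx : HasDerivAt x x' t) (hy : HasDerivAt y y' t)
    (hyx : y t < x t)
    (hm : ∀ m' > m, ∀ᶠ z in 𝓝[>] t, ∀ v, k z v - k t v ≤ m' * (z - t))
    (hr : k t (x t) * x' - k t (y t) * y' + m * (x t - y t) < r) :
    ∀ᶠ z in 𝓝[>] t, (∫ v in y z..x z, k z v) - (∫ v in y t..x t, k t v) < r * (z - t) := by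
  have hkz : ∀ z a b, IntervalIntegrable (k z) volume a b := fun z a b =>
    (hk.comp (by fun_prop : Continuous fun v => (z, v))).intervalIntegrable a b
  set D := k t (x t) * x' - k t (y t) * y' with hD
  have hpos : 0 < x t - y t := sub_pos.2 hyx
  obtain ⟨m', hm', hm'r⟩ : ∃ m' > m, D + m' * (x t - y t) < r := by
    obtain ⟨m', h1, h2⟩ := exists_between ((lt_div_iff₀ hpos).2 (by linarith :
      m * (x t - y t) < r - D))
    exact ⟨m', h1, by linarith [(lt_div_iff₀ hpos).1 h2]⟩
  have hder := (hasDerivAt_integral_of_continuous hk hx).sub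
    (hasDerivAt_integral_of_continuous hk hy)
  have hslope := (hasDerivWithinAt_iff_tendsto_slope' (by simp)).1
    (hder.hasDerivWithinAt (s := Set.Ioi t))
  filter_upwards [hslope.eventually_lt_const (show _ < r - m' * (x t - y t) by linarith),
    hm m' hm', self_mem_nhdsWithin] with z hz hmz htz
  have htz' : 0 < z - t := sub_pos.2 htz
  rw [slope_def_field, div_lt_iff₀ htz'] at hz
  simp only [Pi.sub_apply, intervalIntegral.integral_same, sub_zero] at hz
  have hI : (∫ v in y t..x t, k z v) - (∫ v in y t..x t, k t v)
      ≤ m' * (z - t) * (x t - y t) := by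
    rw [← intervalIntegral.integral_sub (hkz _ _ _) (hkz _ _ _)]
    calc _ ≤ ∫ v in y t..x t, m' * (z - t) :=
          intervalIntegral.integral_mono_on hyx.le ((hkz _ _ _).sub (hkz _ _ _)) (by simp)
            fun v _ => hmz v
      _ = _ := by simp; ring
  have hsplit : (∫ v in y z..x z, k z v) = (∫ v in y t..x t, k z v)
      + (∫ v in x t..x z, k z v) - ∫ v in y t..y z, k z v := by
    have h1 := intervalIntegral.integral_add_adjacent_intervals (hkz z (y t) (y z)) (hkz z _ (x z))
    have h2 := intervalIntegral.integral_add_adjacent_intervals (hkz z (y t) (x t)) (hkz z _ (x z))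
    linarith
  rw [hsplit]
  linarith

open Topology in
lemma eventually_inv_sub_inv_le {α : ℝ → ℝ → ℝ} {T t m : ℝ} {A : ℝ → ℝ} {A₀ : ℝ → ℝ}
    (hpos : ∀ s ≥ T, ∀ v, 0 < α s v)
    (hα : ∀ v, ∀ s ≥ T, ∃ da, HasDerivAt (fun s => α s v) da s ∧ A s * α s v ^ 2 ≤ da)
    (hA : ∀ s ≥ T, A₀ s ≤ A s) (ht : T ≤ t) (hAc : ContinuousWithinAt A₀ (Set.Ici T) t)
    (hm : -A₀ t < m) :
    ∀ᶠ z in 𝓝[>] t, ∀ v, (α z v)⁻¹ - (α t v)⁻¹ ≤ m * (z - t) := by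
  have hev : ∀ᶠ s in 𝓝[≥] t, -A₀ s < m :=
    (hAc.mono (Set.Ici_subset_Ici.2 ht)).neg.eventually_lt continuousWithinAt_const hm
  obtain ⟨u, htu, hu⟩ := mem_nhdsGE_iff_exists_Ico_subset.1 hev
  filter_upwards [Ioo_mem_nhdsGT htu] with z hz v
  choose! da hda hle using hα v
  have hder : ∀ s ∈ Set.Icc t z, HasDerivAt (fun s => (α s v)⁻¹) (-da s / α s v ^ 2) s :=
    fun s hs => (hda s (ht.trans hs.1)).inv (hpos s (ht.trans hs.1) v).ne'
  refine (convex_Icc t z).image_sub_le_mul_sub_of_deriv_le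
    (fun s hs => (hder s hs).continuousAt.continuousWithinAt)
    (fun s hs => (hder s (interior_subset hs)).differentiableAt.differentiableWithinAt)
    (fun s hs => ?_) t (by simp [hz.1.le]) z (by simp [hz.1.le]) hz.1.le
  have hs' := interior_subset hs
  rw [(hder s hs').deriv, neg_div]
  have hTs := ht.trans hs'.1
  have h1 : A s ≤ da s / α s v ^ 2 := (le_div_iff₀ (pow_pos (hpos s hTs v) 2)).2 (hle s hTs)
  have h2 : -A₀ s < m := hu ⟨hs'.1, hs'.2.trans_lt hz.2⟩
  linarith [hA s hTs]

lemma integral_inv_bounds {φ : ℝ → ℝ} (hφ : Continuous φ) {lo hi : ℝ} (hlo : 0 < lo)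
    (hb : ∀ v, lo ≤ φ v ∧ φ v ≤ hi) (p q : ℝ) :
    lo * |∫ v in p..q, (φ v)⁻¹| ≤ |q - p| ∧ |q - p| ≤ hi * |∫ v in p..q, (φ v)⁻¹| := by
  have hhi : 0 < hi := hlo.trans_le ((hb 0).1.trans (hb 0).2)
  wlog hpq : p ≤ q generalizing p q
  · rw [intervalIntegral.integral_symm, abs_neg, abs_sub_comm]
    exact this q p (le_of_not_ge hpq)
  have hpos : ∀ v, 0 < φ v := fun v => hlo.trans_le (hb v).1
  have hint : IntervalIntegrable (fun v => (φ v)⁻¹) volume p q :=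
    (hφ.inv₀ fun v => (hpos v).ne').intervalIntegrable _ _
  rw [abs_of_nonneg (intervalIntegral.integral_nonneg hpq fun v _ => (inv_pos.2 (hpos v)).le),
    abs_of_nonneg (sub_nonneg.2 hpq)]
  have h1 : ∫ v in p..q, (φ v)⁻¹ ≤ ∫ v in p..q, lo⁻¹ :=
    intervalIntegral.integral_mono_on hpq hint (by simp) fun v _ => inv_anti₀ hlo (hb v).1
  have h2 : ∫ v in p..q, hi⁻¹ ≤ ∫ v in p..q, (φ v)⁻¹ :=
    intervalIntegral.integral_mono_on hpq (by simp) hint fun v _ => inv_anti₀ (hpos v) (hb v).2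
  simp only [intervalIntegral.integral_const, smul_eq_mul, ← div_eq_mul_inv] at h1 h2
  exact ⟨(le_div_iff₀' hlo).1 h1, (div_le_iff₀' hhi).1 h2⟩

lemma exists_abs_le_Iic {f : ℝ → ℝ} (hf : Continuous f) {t₀ M : ℝ} (hM : ∀ t ≤ t₀, |f t| ≤ M)
    (T : ℝ) : ∃ C, ∀ t ≤ T, |f t| ≤ C := by
  obtain ⟨C, hC⟩ := isCompact_Icc.exists_bound_of_continuousOn (hf.continuousOn (s := Set.Icc t₀ T))
  refine ⟨max M C, fun t ht => ?_⟩
  rcases le_total t t₀ with h | h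
  · exact le_max_of_le_left (hM t h)
  · exact le_max_of_le_right (hC t ⟨h, ht⟩)

lemma abs_setIntegral_sub_le {ν : Measure ℝ} [IsFiniteMeasure ν] {g x y : ℝ → ℝ} {L t Cx Cy : ℝ}
    (hg : Continuous g) (hL : ∀ u v, |g u - g v| ≤ L * |u - v|) (hx : Continuous x)
    (hy : Continuous y) (hCx : ∀ s ≤ t, |x s| ≤ Cx) (hCy : ∀ s ≤ t, |y s| ≤ Cy) :
    |(∫ s in Set.Iic (0 : ℝ), g (x (t + s)) ∂ν) - ∫ s in Set.Iic (0 : ℝ), g (y (t + s)) ∂ν|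
      ≤ L * ∫ s in Set.Iic (0 : ℝ), |x (t + s) - y (t + s)| ∂ν := by
  have hint : ∀ {φ : ℝ → ℝ} {C : ℝ}, Continuous φ → (∀ s ≤ t, |φ s| ≤ C) →
      IntegrableOn (fun s => φ (t + s)) (Set.Iic 0) ν := by
    intro φ C hφ hC
    refine Integrable.of_bound (by fun_prop) C ?_
    filter_upwards [ae_restrict_mem measurableSet_Iic] with s hs
    exact hC _ (by linarith [Set.mem_Iic.1 hs])
  have hcomp : ∀ {φ : ℝ → ℝ} {C : ℝ}, Continuous φ → (∀ s ≤ t, |φ s| ≤ C) →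
      IntegrableOn (fun s => g (φ (t + s))) (Set.Iic 0) ν := by
    intro φ C hφ hC
    obtain ⟨C', hC'⟩ := isCompact_Icc.exists_bound_of_continuousOn
      (hg.continuousOn (s := Set.Icc (-C) C))
    exact hint (φ := fun s => g (φ s)) (C := C') (by fun_prop)
      fun s hs => hC' _ (abs_le.1 (hC s hs))
  have hdiff : IntegrableOn (fun s => |x (t + s) - y (t + s)|) (Set.Iic 0) ν :=
    ((hint hx hCx).sub (hint hy hCy)).abs
  rw [← integral_sub (hcomp hx hCx) (hcomp hy hCy), ← integral_const_mul]
  exact abs_integral_le_integral_abs.trans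
    (integral_mono ((hcomp hx hCx).sub (hcomp hy hCy)).abs (hdiff.const_mul L) fun s => hL _ _)

lemma setIntegral_Iic_le_of_le {ν : Measure ℝ} [IsProbabilityMeasure ν] {z : ℝ → ℝ} {t C : ℝ}
    (hC0 : 0 ≤ C) (hC : ∀ s ≤ t, |z s| ≤ C) :
    ∫ s in Set.Iic (0 : ℝ), |z (t + s)| ∂ν ≤ C := by
  have h := norm_setIntegral_le_of_norm_le_const (μ := ν) (f := fun s => |z (t + s)|) (C := C)
    (measure_lt_top ν (Set.Iic 0)) fun s hs => by
      simpa using hC (t + s) (by linarith [Set.mem_Iic.1 hs])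
  exact (le_abs_self _).trans (h.trans (mul_le_of_le_one_right hC0 measureReal_le_one))

lemma eventually_setIntegral_Iic_le {ν : Measure ℝ} [IsProbabilityMeasure ν] {z : ℝ → ℝ}
    (hz : Continuous z) {C B e : ℝ} (hC : ∀ s, |z s| ≤ C) (hB0 : 0 ≤ B)
    (hB : ∀ᶠ s in atTop, |z s| ≤ B) (he : 0 < e) :
    ∀ᶠ t in atTop, ∫ s in Set.Iic (0 : ℝ), |z (t + s)| ∂ν ≤ B + e := by
  have hlim : Tendsto (fun t => ∫ s in Set.Iic (0 : ℝ), max (|z (t + s)| - B) 0 ∂ν) atTop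
      (nhds (∫ s in Set.Iic (0 : ℝ), (0 : ℝ) ∂ν)) := by
    refine tendsto_integral_filter_of_dominated_convergence (fun _ => C)
      (Eventually.of_forall fun t => by fun_prop)
      (Eventually.of_forall fun t => ae_of_all _ fun s => ?_)
      (integrable_const _) (ae_of_all _ fun s => ?_)
    · have := hC (t + s)
      rw [Real.norm_of_nonneg (le_max_right _ _)]
      exact max_le (by linarith) ((abs_nonneg _).trans this)
    · refine tendsto_const_nhds.congr' ?_
      filter_upwards [(tendsto_atTop_add_const_right atTop s tendsto_id).eventually hB] with t ht
      exact (max_eq_right (sub_nonpos.2 ht)).symm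
  rw [integral_zero] at hlim
  filter_upwards [hlim.eventually_lt_const he] with t ht
  have hint : IntegrableOn (fun s => max (|z (t + s)| - B) 0) (Set.Iic 0) ν := by
    refine Integrable.of_bound (by fun_prop) C (ae_of_all _ fun s => ?_)
    have := hC (t + s)
    rw [Real.norm_of_nonneg (le_max_right _ _)]
    exact max_le (by linarith) ((abs_nonneg _).trans this)
  have hzint : IntegrableOn (fun s => |z (t + s)|) (Set.Iic 0) ν :=
    Integrable.of_bound (by fun_prop) C (ae_of_all _ fun s => by simpa using hC (t + s))
  have h1 : ∫ s in Set.Iic (0 : ℝ), |z (t + s)| ∂ν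
      ≤ ∫ s in Set.Iic (0 : ℝ), (B + max (|z (t + s)| - B) 0) ∂ν :=
    integral_mono hzint ((integrable_const B).add hint) fun s => by
      have := le_max_left (|z (t + s)| - B) 0
      show |z (t + s)| ≤ B + _
      linarith
  rw [integral_add (integrable_const B) hint] at h1
  have h2 : ∫ _ in Set.Iic (0 : ℝ), B ∂ν ≤ B := by
    rw [setIntegral_const, smul_eq_mul]
    exact mul_le_of_le_one_left hB0 measureReal_le_one
  linarith

lemma continuous_integral_between {k : ℝ → ℝ → ℝ} (hk : Continuous (Function.uncurry k))
    {x y : ℝ → ℝ} (hx : Continuous x) (hy : Continuous y) :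
    Continuous fun z => ∫ v in y z..x z, k z v := by
  have hkz : ∀ z a b, IntervalIntegrable (k z) volume a b := fun z a b =>
    (hk.comp (by fun_prop : Continuous fun v => (z, v))).intervalIntegrable a b
  have h := (intervalIntegral.continuous_parametric_intervalIntegral_of_continuous
    (μ := volume) (a₀ := 0) hk hx).sub
      (intervalIntegral.continuous_parametric_intervalIntegral_of_continuous
        (μ := volume) (a₀ := 0) hk hy)
  refine h.congr fun z => ?_
  have := intervalIntegral.integral_add_adjacent_intervals (hkz z 0 (y z)) (hkz z (y z) (x z))
  simp only [Pi.sub_apply]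
  linarith

open Topology in
lemma eventually_abs_integral_inv_le {α : ℝ → ℝ → ℝ} {b : ℝ → ℝ} {A A₀ x y : ℝ → ℝ}
    {lo hi T t β₀ fx fy E c δ : ℝ}
    (hk : Continuous (Function.uncurry fun z v => (α (max z 0) v)⁻¹))
    (hαt : Continuous (α t)) (hT : 0 < T) (ht : T ≤ t)
    (hlo : 0 < lo) (hbd : ∀ s ≥ T, ∀ v, lo ≤ α s v ∧ α s v ≤ hi)
    (hα : ∀ v, ∀ s ≥ T, ∃ da, HasDerivAt (fun s => α s v) da s ∧ A s * α s v ^ 2 ≤ da)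
    (hA : ∀ s ≥ T, A₀ s ≤ A s) (hAc : ContinuousWithinAt A₀ (Set.Ici T) t)
    (hβ : ∀ u v, u ≠ v → β₀ ≤ (b u - b v) / (u - v))
    (hc : 0 ≤ c) (hrate : β₀ + A₀ t = c / lo)
    (hxc : Continuous x) (hyc : Continuous y)
    (hx : HasDerivAt x (α t (x t) * (-b (x t) + fx)) t)
    (hy : HasDerivAt y (α t (y t) * (-b (y t) + fy)) t)
    (hE : |fx - fy| ≤ E)
    (hW : 0 < |∫ v in y t..x t, (α (max t 0) v)⁻¹|)
    (hδ : E - c * |∫ v in y t..x t, (α (max t 0) v)⁻¹| < -δ) :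
    ∀ᶠ z in 𝓝[>] t, |∫ v in y z..x z, (α (max z 0) v)⁻¹|
      ≤ |∫ v in y t..x t, (α (max t 0) v)⁻¹| - δ * (z - t) := by
  have hmax : ∀ z, t ≤ z → max z 0 = z := fun z hz => max_eq_left (by linarith)
  wlog hyx : y t < x t generalizing x y fx fy
  · have hne : x t ≠ y t := by
      rintro h
      simp [h] at hW
    have hsymm : ∀ z, |∫ v in y z..x z, (α (max z 0) v)⁻¹|
        = |∫ v in x z..y z, (α (max z 0) v)⁻¹| := fun z => by
      rw [intervalIntegral.integral_symm, abs_neg]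
    simp only [hsymm] at hW hδ ⊢
    exact this hyc hxc hy hx (abs_sub_comm fx fy ▸ hE) hW hδ
      (lt_of_le_of_ne (not_lt.1 hyx) hne)
  have hpos : ∀ s ≥ T, ∀ v, 0 < α s v := fun s hs v => hlo.trans_le (hbd s hs v).1
  have hWpos : 0 < ∫ v in y t..x t, (α (max t 0) v)⁻¹ := by
    refine lt_of_le_of_ne (intervalIntegral.integral_nonneg hyx.le fun v _ => ?_)
      (abs_pos.1 hW).symm
    rw [hmax t le_rfl]
    exact (inv_pos.2 (hpos t ht v)).le
  rw [abs_of_pos hWpos] at hδ ⊢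
  have hWle : lo * (∫ v in y t..x t, (α (max t 0) v)⁻¹) ≤ x t - y t := by
    have h := (integral_inv_bounds hαt hlo (hbd t ht) (y t) (x t)).1
    rw [abs_of_pos (sub_pos.2 hyx)] at h
    rw [hmax t le_rfl]
    exact (mul_le_mul_of_nonneg_left (le_abs_self _) hlo.le).trans h
  have hm : ∀ m' > -A₀ t, ∀ᶠ z in 𝓝[>] t, ∀ v,
      (α (max z 0) v)⁻¹ - (α (max t 0) v)⁻¹ ≤ m' * (z - t) := by
    intro m' hm'
    filter_upwards [eventually_inv_sub_inv_le hpos hα hA ht hAc hm', self_mem_nhdsWithin]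
      with z hz htz
    rw [hmax t le_rfl, hmax z (le_of_lt htz)]
    exact hz
  have hslope : (α (max t 0) (x t))⁻¹ * (α t (x t) * (-b (x t) + fx))
      - (α (max t 0) (y t))⁻¹ * (α t (y t) * (-b (y t) + fy)) + -A₀ t * (x t - y t) < -δ := by
    rw [hmax t le_rfl, inv_mul_cancel_left₀ (hpos t ht _).ne',
      inv_mul_cancel_left₀ (hpos t ht _).ne']
    have h1 := (le_div_iff₀ (sub_pos.2 hyx)).1 (hβ (x t) (y t) hyx.ne')
    have h2 : c * (∫ v in y t..x t, (α (max t 0) v)⁻¹) ≤ (β₀ + A₀ t) * (x t - y t) := by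
      rw [hrate, div_mul_eq_mul_div, le_div_iff₀ hlo]
      calc _ = c * (lo * ∫ v in y t..x t, (α (max t 0) v)⁻¹) := by ring
        _ ≤ _ := mul_le_mul_of_nonneg_left hWle hc
    linarith [le_abs_self (fx - fy)]
  have hWc := (continuous_integral_between hk hxc hyc).continuousAt (x := t)
  filter_upwards [eventually_integral_sub_lt hk hx hy hyx hm hslope,
    (hWc.mono_left nhdsWithin_le_nhds).eventually_const_lt hWpos] with z hz hz0
  rw [abs_of_pos hz0]
  linarith

section Comparison

variable {ι : Type*} {z w : ι → ℝ → ℝ} {N : ι → ℝ} {T ε s₀ : ℝ} {Inp : ℝ → ℝ → Prop}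

open Topology in
lemma exists_forall_abs_le_of_decay [Finite ι] (hN : ∀ i, 0 < N i) (hε : 0 < ε) (hs₀ : 0 < s₀)
    (hw : ∀ i, Continuous (w i)) (hzw : ∀ i, ∀ t ≥ T, |z i t| ≤ N i * w i t)
    (hdecay : ∀ i, ∀ t ≥ T, ∀ Q r δ, 0 < r → δ < ε * r → s₀ * Q + δ < (ε + s₀) * r →
      Inp Q t → r ≤ w i t → ∀ᶠ u in 𝓝[>] t, w i u ≤ w i t - δ * (u - t))
    (hInp : ∀ t ≥ T, ∀ Q ≥ 0, (∀ s ≤ t, ∀ i, |z i s| ≤ N i * Q) → Inp Q t)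
    (hinit : ∀ i, ∃ C, ∀ s ≤ T, |z i s| ≤ C) :
    ∃ K > 0, ∀ i s, |z i s| ≤ N i * K := by
  choose C hC using hinit
  obtain ⟨K₁, hK₁⟩ := (Set.finite_range fun i => max (C i / N i) (w i T)).bddAbove
  have hK₁' : ∀ i, max (C i / N i) (w i T) ≤ K₁ := fun i => hK₁ ⟨i, rfl⟩
  set K := max K₁ 1
  have hK0 : 0 < K := lt_max_of_lt_right one_pos
  have hKz : ∀ i, ∀ s ≤ T, |z i s| ≤ N i * K := fun i s hs =>
    (hC i s hs).trans ((div_le_iff₀' (hN i)).1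
      ((le_max_left _ _).trans ((hK₁' i).trans (le_max_left _ _))))
  have hKw : ∀ i, w i T ≤ K := fun i =>
    (le_max_right _ _).trans ((hK₁' i).trans (le_max_left _ _))
  suffices h : ∀ b ≥ T, ∀ i, w i b ≤ K by
    refine ⟨K, hK0, fun i s => ?_⟩
    rcases le_total s T with hs | hs
    · exact hKz i s hs
    · exact (hzw i s hs).trans (mul_le_mul_of_nonneg_left (h s hs i) (hN i).le)
  intro b hb i
  by_contra! hlt
  have hmax : ∀ j, ∃ s ∈ Set.Icc T b, ∀ u ∈ Set.Icc T b, w j u ≤ w j s := fun j =>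
    isCompact_Icc.exists_isMaxOn ⟨T, by simp [hb]⟩ (hw j).continuousOn
  choose s hs hsmax using hmax
  have : Nonempty ι := ⟨i⟩
  obtain ⟨i₀, hi₀⟩ := Finite.exists_max fun j => w j (s j)
  set M := w i₀ (s i₀)
  have hKM : K < M := hlt.trans_le ((hsmax i b (by simp [hb])).trans (hi₀ i))
  have hM0 : 0 < M := hK0.trans hKM
  have hzM : ∀ t ≤ b, ∀ j, |z j t| ≤ N j * M := by
    intro t ht j
    rcases le_total t T with h | h
    · exact (hKz j t h).trans (mul_le_mul_of_nonneg_left hKM.le (hN j).le)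
    · exact (hzw j t h).trans
        (mul_le_mul_of_nonneg_left ((hsmax j t ⟨h, ht⟩).trans (hi₀ j)) (hN j).le)
  have hq : s₀ * M / (ε + s₀) < M := by
    rw [div_lt_iff₀ (by positivity)]
    nlinarith
  obtain ⟨r, hr, hrM⟩ := exists_between (max_lt hKM hq)
  have hKr : K < r := (le_max_left _ _).trans_lt hr
  have hr0 : 0 < r := hK0.trans hKr
  have hr' : s₀ * M < (ε + s₀) * r :=
    (div_lt_iff₀' (by positivity)).1 ((le_max_right _ _).trans_lt hr)
  have hle := le_max_sub_mul_of_eventually_le (r := r) (δ := 0) (hw i₀).continuousOn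
    (fun t ht hrt => hdecay i₀ t ht.1 M r 0 hr0 (by positivity) (by linarith)
      (hInp t ht.1 M hM0.le fun s hs => hzM s (hs.trans ht.2.le)) hrt) le_rfl (s i₀) (hs i₀)
  rw [zero_mul, sub_zero, max_eq_left ((hKw i₀).trans hKr.le)] at hle
  exact absurd hrM (not_lt.2 hle)

open Topology in
lemma eventually_le_of_decay {w : ℝ → ℝ} {r δ : ℝ} (hw : Continuous w) (hδ : 0 < δ)
    (h : ∀ᶠ t in atTop, r ≤ w t → ∀ᶠ u in 𝓝[>] t, w u ≤ w t - δ * (u - t)) :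
    ∀ᶠ t in atTop, w t ≤ r := by
  obtain ⟨T, hT⟩ := eventually_atTop.1 h
  filter_upwards [eventually_ge_atTop T, eventually_ge_atTop (T + (w T - r) / δ)] with t ht ht'
  have hle := le_max_sub_mul_of_eventually_le (hw.continuousOn (s := Set.Icc T t))
    (fun s hs => hT s hs.1) hδ.le t ⟨ht, le_rfl⟩
  have h1 : (w T - r) / δ ≤ t - T := by linarith
  rw [div_le_iff₀' hδ] at h1
  rwa [max_eq_left (by linarith)] at hle

open Topology in
lemma tendsto_zero_of_decay [Finite ι] (hN : ∀ i, 0 < N i) (hε : 0 < ε) (hs₀ : 0 < s₀)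
    (hw : ∀ i, Continuous (w i)) (hzw : ∀ i, ∀ t ≥ T, |z i t| ≤ N i * w i t)
    (hdecay : ∀ i, ∀ t ≥ T, ∀ Q r δ, 0 < r → δ < ε * r → s₀ * Q + δ < (ε + s₀) * r →
      Inp Q t → r ≤ w i t → ∀ᶠ u in 𝓝[>] t, w i u ≤ w i t - δ * (u - t))
    {K : ℝ} (hK0 : 0 < K) (hK : ∀ i s, |z i s| ≤ N i * K)
    (hInp : ∀ B ≥ 0, ∀ e > 0, (∀ᶠ t in atTop, ∀ i, |z i t| ≤ N i * B) →
      ∀ᶠ t in atTop, Inp (B + e) t) (i : ι) :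
    Tendsto (z i) atTop (𝓝 0) := by
  set θ := (s₀ + ε / 2) / (s₀ + ε) with hθ
  have hθ0 : 0 < θ := by positivity
  have hθ1 : θ < 1 := (div_lt_one (by positivity)).2 (by linarith)
  have hθmul : (ε + s₀) * θ = s₀ + ε / 2 := by
    rw [hθ]
    field_simp
    ring
  have hcontract : ∀ B > 0, (∀ᶠ t in atTop, ∀ i, |z i t| ≤ N i * B) →
      ∀ᶠ t in atTop, ∀ i, |z i t| ≤ N i * (θ * B) := by
    intro B hB hz
    rw [eventually_all]
    intro i
    have he : 0 < ε * B / (4 * s₀) := by positivity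
    have hse : s₀ * (ε * B / (4 * s₀)) = ε * B / 4 := by field_simp
    have hεB : 0 < ε * B := mul_pos hε hB
    obtain ⟨δ, hδ0, hδ⟩ := exists_between
      (lt_min (by positivity : 0 < ε * (θ * B)) (by positivity : 0 < ε * B / 4))
    have hwr : ∀ᶠ t in atTop, w i t ≤ θ * B := by
      refine eventually_le_of_decay (hw i) hδ0 ?_
      filter_upwards [hInp B hB.le _ he hz, eventually_ge_atTop T] with t hIt ht
      refine hdecay i t ht _ _ δ (by positivity) (hδ.trans_le (min_le_left _ _)) ?_ hIt
      have := hδ.trans_le (min_le_right _ _)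
      rw [mul_add, hse, ← mul_assoc, hθmul]
      linarith
    filter_upwards [hwr, eventually_ge_atTop T] with t ht hTt
    exact (hzw i t hTt).trans (mul_le_mul_of_nonneg_left ht (hN i).le)
  have hpow : ∀ n : ℕ, ∀ᶠ t in atTop, ∀ i, |z i t| ≤ N i * (θ ^ n * K) := by
    intro n
    induction n with
    | zero => exact Eventually.of_forall fun t i => by simpa using hK i t
    | succ n ih =>
      refine (hcontract _ (by positivity) ih).mono fun t ht i => (ht i).trans_eq ?_
      ring
  rw [Metric.tendsto_nhds]
  intro e he
  have hlim : Tendsto (fun n : ℕ => N i * (θ ^ n * K)) atTop (𝓝 (N i * (0 * K))) :=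
    ((tendsto_pow_atTop_nhds_zero_of_lt_one hθ0.le hθ1).mul_const K).const_mul _
  obtain ⟨n, hn⟩ := (hlim.eventually_lt_const (by simpa using he)).exists
  filter_upwards [hpow n] with t ht
  simpa using (ht i).trans_lt hn

end Comparison

namespace CGData

variable {n P : ℕ}

/-- The nonnegative sum of weighted interaction strengths in hypothesis (H7). -/
noncomputable def coupling (S : CGData n P) (aU : Fin (n+1) → ℝ)
    (γ1 γ2 μ1 μ2 : Fin (n+1) → Fin (n+1) → Fin (n+1) → Fin (P+1) → ℝ)
    (ξ Ξ : Fin (n+1) → Fin (n+1) → Fin (P+1) → ℝ) (ζ ς : Fin (n+1) → ℝ)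
    (dv : Fin (n+1) → ℝ) (i : Fin (n+1)) (t : ℝ) : ℝ :=
  ∑ p : Fin (P+1), ∑ j : Fin (n+1), ∑ l : Fin (n+1),
    (ζ i * |S.c i j l p t| *
        (aU j * (dv j / dv i) * γ1 i j l p + aU l * (dv l / dv i) * γ2 i j l p)
      + ς i * |S.d i j l p t| *
        (aU j * (dv j / dv i) * ξ i j p * μ1 i j l p
          + aU l * (dv l / dv i) * Ξ i l p * μ2 i j l p))

/-- Every delayed argument of the right-hand side at time `t` differs between `x` and `y` by at
most `Q`, relative to the weights `N` and the Lipschitz constants of the distributed terms. -/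
def InputBound (S : CGData n P) (x y : Fin (n+1) → ℝ → ℝ) (N : Fin (n+1) → ℝ)
    (ξ Ξ : Fin (n+1) → Fin (n+1) → Fin (P+1) → ℝ) (Q t : ℝ) : Prop :=
  (∀ i j p, |x j (t - S.τ i j p t) - y j (t - S.τ i j p t)| ≤ N j * Q) ∧
  (∀ i l p, |x l (t - S.σ i l p t) - y l (t - S.σ i l p t)| ≤ N l * Q) ∧
  (∀ i j p, |(∫ s in Set.Iic (0:ℝ), S.g i j p (x j (t + s)) ∂(S.η i j p))
    - ∫ s in Set.Iic (0:ℝ), S.g i j p (y j (t + s)) ∂(S.η i j p)| ≤ ξ i j p * (N j * Q)) ∧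
  (∀ i l p, |(∫ s in Set.Iic (0:ℝ), S.G i l p (x l (t + s)) ∂(S.ρ i l p))
    - ∫ s in Set.Iic (0:ℝ), S.G i l p (y l (t + s)) ∂(S.ρ i l p)| ≤ Ξ i l p * (N l * Q))

/-- The distance between the `i`-th components of `x` and `y` at time `t`, measured with the
density `1 / a i t`. -/
noncomputable def invDist (S : CGData n P) (x y : Fin (n+1) → ℝ → ℝ) (i : Fin (n+1)) (t : ℝ) : ℝ :=
  |∫ v in y i t..x i t, (S.a i (max t 0) v)⁻¹|

variable {S : CGData n P} {aL aU : Fin (n+1) → ℝ} {A β : Fin (n+1) → ℝ → ℝ}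
  {γ1 γ2 μ1 μ2 : Fin (n+1) → Fin (n+1) → Fin (n+1) → Fin (P+1) → ℝ}
  {ξ Ξ : Fin (n+1) → Fin (n+1) → Fin (P+1) → ℝ} {ζ ς dv N : Fin (n+1) → ℝ}
  {x y : Fin (n+1) → ℝ → ℝ}

lemma coupling_nonneg (haU : ∀ i, 0 < aU i) (hdv : ∀ i, 0 < dv i) (h5 : S.H5 γ1 γ2 μ1 μ2)
    (h6 : S.H6 ξ Ξ ζ ς) (i : Fin (n+1)) (t : ℝ) :
    0 ≤ S.coupling aU γ1 γ2 μ1 μ2 ξ Ξ ζ ς dv i t := by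
  obtain ⟨hpos, -, -⟩ := h5
  obtain ⟨hξ, hΞ, hζ, -⟩ := h6
  refine Finset.sum_nonneg fun p _ => Finset.sum_nonneg fun j _ => Finset.sum_nonneg fun l _ => ?_
  obtain ⟨h1, h2, h3, h4⟩ := hpos i j l p
  have := hξ i j p
  have := hΞ i l p
  have := (hζ i).1
  have := (hζ i).2
  have := haU j
  have := haU l
  have := hdv i
  have := hdv j
  have := hdv l
  positivity

lemma continuousOn_coupling (hreg : S.Regular) (i : Fin (n+1)) :
    ContinuousOn (S.coupling aU γ1 γ2 μ1 μ2 ξ Ξ ζ ς dv i) (Set.Ici 0) := by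
  obtain ⟨-, -, -, hc, hd, -⟩ := hreg
  unfold coupling
  refine continuousOn_finsetSum _ fun p _ => continuousOn_finsetSum _ fun j _ =>
    continuousOn_finsetSum _ fun l _ => ?_
  exact ((continuousOn_const.mul (hc i j l p).abs).mul continuousOn_const).add
    ((continuousOn_const.mul (hd i j l p).abs).mul continuousOn_const)

lemma exists_coupling_le (haU : ∀ i, 0 < aU i) (hdv : ∀ i, 0 < dv i) (h1 : S.H1)
    (h5 : S.H5 γ1 γ2 μ1 μ2) (h6 : S.H6 ξ Ξ ζ ς) :
    ∃ s₀ > 0, ∀ i, ∀ t ≥ 0, S.coupling aU γ1 γ2 μ1 μ2 ξ Ξ ζ ς dv i t ≤ s₀ := by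
  obtain ⟨hpos, -, -⟩ := h5
  obtain ⟨hξ, hΞ, hζ, -⟩ := h6
  obtain ⟨hc, hd, -⟩ := h1
  choose Mc hMc using hc
  choose Md hMd using hd
  have hi : ∀ i, ∃ C, ∀ t ≥ 0, S.coupling aU γ1 γ2 μ1 μ2 ξ Ξ ζ ς dv i t ≤ C := by
    intro i
    refine ⟨_, fun t ht => Finset.sum_le_sum fun p _ => Finset.sum_le_sum fun j _ =>
      Finset.sum_le_sum fun l _ => add_le_add
        (mul_le_mul_of_nonneg_right
          (mul_le_mul_of_nonneg_left (hMc i j l p t ht) (hζ i).1.le) ?_)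
        (mul_le_mul_of_nonneg_right
          (mul_le_mul_of_nonneg_left (hMd i j l p t ht) (hζ i).2.le) ?_)⟩
    all_goals
      obtain ⟨h1, h2, h3, h4⟩ := hpos i j l p
      have := hξ i j p
      have := hΞ i l p
      have := haU j
      have := haU l
      have := hdv i
      have := hdv j
      have := hdv l
      positivity
  choose C hC using hi
  obtain ⟨s, hs⟩ := (Set.finite_range C).bddAbove
  exact ⟨max s 1, lt_max_of_lt_right one_pos, fun i t ht =>
    (hC i t ht).trans ((hs ⟨i, rfl⟩).trans (le_max_left _ _))⟩

lemma abs_F_sub_le (hdv : ∀ i, 0 < dv i) (h5 : S.H5 γ1 γ2 μ1 μ2) (h6 : S.H6 ξ Ξ ζ ς)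
    {Q t : ℝ} (hQ : S.InputBound x y (fun j => aU j * dv j) ξ Ξ Q t) (i : Fin (n+1)) :
    |S.F i (S.U x i t) (S.V x i t) - S.F i (S.U y i t) (S.V y i t)|
      ≤ dv i * (S.coupling aU γ1 γ2 μ1 μ2 ξ Ξ ζ ς dv i t * Q) := by
  obtain ⟨hpos, hh, hf⟩ := h5
  obtain ⟨-, -, hζ, -, -, hF⟩ := h6
  obtain ⟨hQτ, hQσ, hQg, hQG⟩ := hQ
  have hU : |S.U x i t - S.U y i t| ≤ ∑ p : Fin (P+1), ∑ j : Fin (n+1), ∑ l : Fin (n+1),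
      |S.c i j l p t| * (γ1 i j l p * (aU j * dv j * Q) + γ2 i j l p * (aU l * dv l * Q)) := by
    simp only [U, ← Finset.sum_sub_distrib, ← mul_sub]
    refine (Finset.abs_sum_le_sum_abs _ _).trans (Finset.sum_le_sum fun p _ => ?_)
    refine (Finset.abs_sum_le_sum_abs _ _).trans (Finset.sum_le_sum fun j _ => ?_)
    refine (Finset.abs_sum_le_sum_abs _ _).trans (Finset.sum_le_sum fun l _ => ?_)
    rw [abs_mul]
    obtain ⟨h1, h2, -, -⟩ := hpos i j l p
    exact mul_le_mul_of_nonneg_left ((hh i j l p _ _ _ _).trans (add_le_add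
      (mul_le_mul_of_nonneg_left (hQτ i j p) h1.le)
      (mul_le_mul_of_nonneg_left (hQσ i l p) h2.le))) (abs_nonneg _)
  have hV : |S.V x i t - S.V y i t| ≤ ∑ p : Fin (P+1), ∑ j : Fin (n+1), ∑ l : Fin (n+1),
      |S.d i j l p t| * (μ1 i j l p * (ξ i j p * (aU j * dv j * Q))
        + μ2 i j l p * (Ξ i l p * (aU l * dv l * Q))) := by
    simp only [V, ← Finset.sum_sub_distrib, ← mul_sub]
    refine (Finset.abs_sum_le_sum_abs _ _).trans (Finset.sum_le_sum fun p _ => ?_)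
    refine (Finset.abs_sum_le_sum_abs _ _).trans (Finset.sum_le_sum fun j _ => ?_)
    refine (Finset.abs_sum_le_sum_abs _ _).trans (Finset.sum_le_sum fun l _ => ?_)
    rw [abs_mul]
    obtain ⟨-, -, h3, h4⟩ := hpos i j l p
    exact mul_le_mul_of_nonneg_left ((hf i j l p _ _ _ _).trans (add_le_add
      (mul_le_mul_of_nonneg_left (hQg i j p) h3.le)
      (mul_le_mul_of_nonneg_left (hQG i l p) h4.le))) (abs_nonneg _)
  refine (hF i _ _ _ _).trans ((add_le_add (mul_le_mul_of_nonneg_left hU (hζ i).1.le)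
    (mul_le_mul_of_nonneg_left hV (hζ i).2.le)).trans_eq ?_)
  simp only [coupling, Finset.mul_sum, Finset.sum_mul, ← Finset.sum_add_distrib]
  refine Finset.sum_congr rfl fun p _ => Finset.sum_congr rfl fun j _ =>
    Finset.sum_congr rfl fun l _ => ?_
  have := (hdv i).ne'
  field_simp

lemma inputBound_of_forall_le (hreg : S.Regular) (h6 : S.H6 ξ Ξ ζ ς) (hN : ∀ j, 0 < N j)
    (hx : ∀ j, Continuous (x j)) (hy : ∀ j, Continuous (y j))
    {t Q : ℝ} (ht : 0 ≤ t) (hQ : 0 ≤ Q) (hbx : ∀ j, ∃ C, ∀ s ≤ t, |x j s| ≤ C)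
    (hby : ∀ j, ∃ C, ∀ s ≤ t, |y j s| ≤ C) (h : ∀ s ≤ t, ∀ j, |x j s - y j s| ≤ N j * Q) :
    S.InputBound x y N ξ Ξ Q t := by
  obtain ⟨-, -, -, -, -, -, -, -, hτ, hσ, -, -, -, hg, hG, hη, hρ⟩ := hreg
  obtain ⟨hξ, hΞ, -, hgL, hGL, -⟩ := h6
  have hNQ : ∀ j, 0 ≤ N j * Q := fun j => mul_nonneg (hN j).le hQ
  choose Cx hCx using hbx
  choose Cy hCy using hby
  refine ⟨fun i j p => h _ (sub_le_self _ (hτ i j p t ht)) j,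
    fun i l p => h _ (sub_le_self _ (hσ i l p t ht)) l, fun i j p => ?_, fun i l p => ?_⟩
  · have := (hη i j p).1
    exact (abs_setIntegral_sub_le (hg i j p) (hgL i j p) (hx j) (hy j) (hCx j) (hCy j)).trans
      (mul_le_mul_of_nonneg_left (setIntegral_Iic_le_of_le (z := fun s => x j s - y j s) (hNQ j)
        fun s hs => h s hs j) (hξ i j p).le)
  · have := (hρ i l p).1
    exact (abs_setIntegral_sub_le (hG i l p) (hGL i l p) (hx l) (hy l) (hCx l) (hCy l)).trans
      (mul_le_mul_of_nonneg_left (setIntegral_Iic_le_of_le (z := fun s => x l s - y l s) (hNQ l)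
        fun s hs => h s hs l) (hΞ i l p).le)

lemma eventually_inputBound (hreg : S.Regular) (h4 : S.H4) (h6 : S.H6 ξ Ξ ζ ς)
    (hN : ∀ j, 0 < N j) (hx : ∀ j, Continuous (x j)) (hy : ∀ j, Continuous (y j))
    (hbx : ∀ t j, ∃ C, ∀ s ≤ t, |x j s| ≤ C) (hby : ∀ t j, ∃ C, ∀ s ≤ t, |y j s| ≤ C)
    {K : ℝ} (hK : ∀ j s, |x j s - y j s| ≤ N j * K) {B e : ℝ} (hB : 0 ≤ B) (he : 0 < e)
    (h : ∀ᶠ t in atTop, ∀ j, |x j t - y j t| ≤ N j * B) :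
    ∀ᶠ t in atTop, S.InputBound x y N ξ Ξ (B + e) t := by
  obtain ⟨-, -, -, -, -, -, -, -, hτ, hσ, -, -, -, hg, hG, hη, hρ⟩ := hreg
  obtain ⟨hξ, hΞ, -, hgL, hGL, -⟩ := h6
  have hle : ∀ j, N j * B ≤ N j * (B + e) := fun j =>
    mul_le_mul_of_nonneg_left (by linarith) (hN j).le
  simp only [InputBound, eventually_and, eventually_all]
  refine ⟨fun i j p => ?_, fun i l p => ?_, fun i j p => ?_, fun i l p => ?_⟩
  · filter_upwards [(h4.1 i j p).eventually h] with t ht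
    exact (ht j).trans (hle j)
  · filter_upwards [(h4.2 i l p).eventually h] with t ht
    exact (ht l).trans (hle l)
  · have := (hη i j p).1
    filter_upwards [eventually_setIntegral_Iic_le (ν := S.η i j p) (z := fun s => x j s - y j s)
      ((hx j).sub (hy j)) (hK j) (mul_nonneg (hN j).le hB) (h.mono fun t ht => ht j)
      (mul_pos (hN j) he)] with t ht
    rw [mul_add]
    exact (abs_setIntegral_sub_le (hg i j p) (hgL i j p) (hx j) (hy j) (hbx t j).choose_spec
      (hby t j).choose_spec).trans (mul_le_mul_of_nonneg_left ht (hξ i j p).le)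
  · have := (hρ i l p).1
    filter_upwards [eventually_setIntegral_Iic_le (ν := S.ρ i l p) (z := fun s => x l s - y l s)
      ((hx l).sub (hy l)) (hK l) (mul_nonneg (hN l).le hB) (h.mono fun t ht => ht l)
      (mul_pos (hN l) he)] with t ht
    rw [mul_add]
    exact (abs_setIntegral_sub_le (hG i l p) (hGL i l p) (hx l) (hy l) (hbx t l).choose_spec
      (hby t l).choose_spec).trans (mul_le_mul_of_nonneg_left ht (hΞ i l p).le)

lemma exists_H7expr_le (h7 : S.H7 aL aU A β γ1 γ2 μ1 μ2 ξ Ξ ζ ς dv) :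
    ∃ ε > 0, ∀ᶠ t in atTop, ∀ i, S.H7expr aL aU A β γ1 γ2 μ1 μ2 ξ Ξ ζ ς dv i t ≤ -ε := by
  have hi : ∀ i, ∃ ε > 0, ∀ᶠ t in atTop,
      S.H7expr aL aU A β γ1 γ2 μ1 μ2 ξ Ξ ζ ς dv i t ≤ -ε := by
    intro i
    have hlim := h7.2 i
    rw [limsup_eq] at hlim
    have hne : {a | ∀ᶠ t in atTop,
        S.H7expr aL aU A β γ1 γ2 μ1 μ2 ξ Ξ ζ ς dv i t ≤ a}.Nonempty := by
      by_contra hempty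
      rw [Set.not_nonempty_iff_eq_empty.1 hempty, Real.sInf_empty] at hlim
      exact lt_irrefl _ hlim
    obtain ⟨a, ha, ha0⟩ := exists_lt_of_csInf_lt hne hlim
    exact ⟨-a, neg_pos.2 ha0, by simpa using ha⟩
  choose ε hε0 hε using hi
  refine ⟨Finset.univ.inf' Finset.univ_nonempty ε, by simpa using hε0, eventually_all.2 fun i => ?_⟩
  exact (hε i).mono fun t ht => ht.trans
    (neg_le_neg (Finset.inf'_le ε (Finset.mem_univ i)))

lemma continuous_inv_a (hreg : S.Regular) (i : Fin (n+1)) :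
    Continuous (Function.uncurry fun z v => (S.a i (max z 0) v)⁻¹) := by
  have h : Continuous fun q : ℝ × ℝ => S.a i (max q.1 0) q.2 :=
    (hreg.1 i).comp_continuous (f := fun q : ℝ × ℝ => (max q.1 0, q.2)) (by fun_prop)
      fun q => ⟨Set.mem_Ici.2 (le_max_right _ _), Set.mem_univ _⟩
  exact h.inv₀ fun q => (hreg.2.1 i _ (le_max_right _ _) _).ne'

lemma continuous_a_right (hreg : S.Regular) (i : Fin (n+1)) {t : ℝ} (ht : 0 ≤ t) :
    Continuous (S.a i t) :=
  (hreg.1 i).comp_continuous (f := fun v => (t, v)) (by fun_prop) fun _ => ⟨ht, Set.mem_univ _⟩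

lemma invDist_bounds (hreg : S.Regular) (h2 : S.H2 aL aU A) (i : Fin (n+1)) {t : ℝ}
    (ht : 0 ≤ t) : |x i t - y i t| ≤ aU i * S.invDist x y i t := by
  rw [invDist, max_eq_left ht]
  exact (integral_inv_bounds (continuous_a_right hreg i ht) (h2.1 i) (h2.2.2.1 i t ht) _ _).2

open Topology in
lemma eventually_invDist_le (hreg : S.Regular) (h2 : S.H2 aL aU A) (h3 : S.H3 β)
    (h5 : S.H5 γ1 γ2 μ1 μ2) (h6 : S.H6 ξ Ξ ζ ς) (hdv : ∀ i, 0 < dv i) {T ε s₀ : ℝ}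
    (hT : 0 < T) (hε : 0 < ε)
    (h7 : ∀ t ≥ T, ∀ i, S.H7expr aL aU A β γ1 γ2 μ1 μ2 ξ Ξ ζ ς dv i t ≤ -ε)
    (hs₀ : ∀ i, ∀ t ≥ 0, S.coupling aU γ1 γ2 μ1 μ2 ξ Ξ ζ ς dv i t ≤ s₀)
    (hxc : ∀ i, Continuous (x i)) (hyc : ∀ i, Continuous (y i))
    (hx : ∀ i, ∀ t ≥ T, HasDerivAt (x i) (S.rhs x i t) t)
    (hy : ∀ i, ∀ t ≥ T, HasDerivAt (y i) (S.rhs y i t) t) (i : Fin (n+1)) {t Q r δ : ℝ}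
    (ht : T ≤ t) (hr : 0 < r) (hδ : δ < ε * r) (hδQ : s₀ * Q + δ < (ε + s₀) * r)
    (hQ : S.InputBound x y (fun j => aU j * dv j) ξ Ξ Q t)
    (hrw : r ≤ S.invDist x y i t / dv i) :
    ∀ᶠ u in 𝓝[>] t, S.invDist x y i u / dv i ≤ S.invDist x y i t / dv i - δ * (u - t) := by
  have haL := h2.1 i
  have haU : ∀ j, 0 < aU j := fun j => (h2.1 j).trans_le (h2.2.1 j)
  set κ := S.coupling aU γ1 γ2 μ1 μ2 ξ Ξ ζ ς dv i with hκ
  have hκ0 : 0 ≤ κ t := coupling_nonneg haU hdv h5 h6 i t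
  have hκs : κ t ≤ s₀ := hs₀ i t (by linarith)
  have hrate : ∀ s ≥ T, -β i s + (ε + κ s) / aL i ≤ A i s := by
    intro s hs
    have h := h7 s hs i
    have h' : ε + κ s ≤ aL i * (β i s + A i s) := by
      change -(aL i * (β i s + A i s)) + κ s ≤ -ε at h
      linarith
    linarith [(div_le_iff₀' haL).2 h']
  have hcont : ContinuousWithinAt (fun s => -β i s + (ε + κ s) / aL i) (Set.Ici T) t :=
    (((h3.1 i).neg.add ((continuousOn_const.add (continuousOn_coupling hreg i)).div_const _)) t
      (hT.le.trans ht)).mono (Set.Ici_subset_Ici.2 hT.le)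
  have hw : dv i * r ≤ S.invDist x y i t := (le_div_iff₀' (hdv i)).1 hrw
  have hkey : κ t * Q - (ε + κ t) * r < -δ := by
    rcases le_total r Q with h | h
    · nlinarith
    · nlinarith
  have hmain := eventually_abs_integral_inv_le (b := S.b i t) (β₀ := β i t) (c := ε + κ t)
    (δ := dv i * δ) (fx := S.F i (S.U x i t) (S.V x i t) + S.I i t)
    (fy := S.F i (S.U y i t) (S.V y i t) + S.I i t)
    (continuous_inv_a hreg i) (continuous_a_right hreg i (by linarith)) hT ht haL
    (fun s hs => h2.2.2.1 i s (by linarith)) (fun v s hs => h2.2.2.2 i v s (by linarith))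
    hrate hcont (h3.2.2 i t (by linarith)) (by positivity) (by ring) (hxc i) (hyc i)
    (by simpa only [rhs, add_assoc] using hx i t ht)
    (by simpa only [rhs, add_assoc] using hy i t ht)
    (by simpa only [add_sub_add_right_eq_sub] using abs_F_sub_le hdv h5 h6 hQ i)
    ((mul_pos (hdv i) hr).trans_le hw)
    (by
      have h1 := mul_le_mul_of_nonneg_left hw (by positivity : 0 ≤ ε + κ t)
      have h2 := mul_lt_mul_of_pos_left hkey (hdv i)
      change dv i * (κ t * Q) - (ε + κ t) * S.invDist x y i t < -(dv i * δ)
      linarith)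
  filter_upwards [hmain] with u hu
  change S.invDist x y i u ≤ S.invDist x y i t - dv i * δ * (u - t) at hu
  rw [div_le_iff₀' (hdv i), mul_sub, mul_div_cancel₀ _ (hdv i).ne']
  linarith

end CGData

open CGData

/-- Corollary 3.4: under (H1)-(H7), any two solutions of system (1) with bounded initial
conditions (possibly at different initial times) approach each other in the max norm. -/
theorem global_convergence_of_solutions {n P : ℕ} (S : CGData n P)
    (aL aU : Fin (n+1) → ℝ) (A : Fin (n+1) → ℝ → ℝ) (β : Fin (n+1) → ℝ → ℝ)
    (γ1 γ2 μ1 μ2 : Fin (n+1) → Fin (n+1) → Fin (n+1) → Fin (P+1) → ℝ)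
    (ξ Ξ : Fin (n+1) → Fin (n+1) → Fin (P+1) → ℝ) (ζ ς : Fin (n+1) → ℝ)
    (dv : Fin (n+1) → ℝ)
    (hreg : S.Regular)
    (h1 : S.H1) (h2 : S.H2 aL aU A) (h3 : S.H3 β) (h4 : S.H4)
    (h5 : S.H5 γ1 γ2 μ1 μ2) (h6 : S.H6 ξ Ξ ζ ς)
    (h7 : S.H7 aL aU A β γ1 γ2 μ1 μ2 ξ Ξ ζ ς dv)
    (t₀ t₁ : ℝ) (ht₀ : 0 ≤ t₀) (ht₁ : 0 ≤ t₁)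
    (x y : Fin (n+1) → ℝ → ℝ)
    (hx : S.IsSolution t₀ x) (hy : S.IsSolution t₁ y) :
    Tendsto (fun t => Finset.univ.sup' Finset.univ_nonempty (fun i => |x i t - y i t|))
      atTop (nhds 0) := by
  obtain ⟨hxc, ⟨Mx, hMx⟩, hxd⟩ := hx
  obtain ⟨hyc, ⟨My, hMy⟩, hyd⟩ := hy
  have haU : ∀ j, 0 < aU j := fun j => (h2.1 j).trans_le (h2.2.1 j)
  have hdv := h7.1
  have hN : ∀ j, 0 < aU j * dv j := fun j => mul_pos (haU j) (hdv j)
  have hbx : ∀ t j, ∃ C, ∀ s ≤ t, |x j s| ≤ C := fun t j => exists_abs_le_Iic (hxc j) (hMx j) t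
  have hby : ∀ t j, ∃ C, ∀ s ≤ t, |y j s| ≤ C := fun t j => exists_abs_le_Iic (hyc j) (hMy j) t
  obtain ⟨ε, hε, h7ev⟩ := exists_H7expr_le h7
  obtain ⟨s₀, hs₀, hcoup⟩ := exists_coupling_le haU hdv h1 h5 h6
  obtain ⟨T, hT⟩ := eventually_atTop.1
    (h7ev.and ((eventually_gt_atTop t₀).and (eventually_gt_atTop t₁)))
  have hT0 : 0 < T := ht₀.trans_lt (hT T le_rfl).2.1
  have hw : ∀ i, Continuous fun t => S.invDist x y i t / dv i := fun i =>
    (continuous_integral_between (continuous_inv_a hreg i) (hxc i) (hyc i)).abs.div_const _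
  have hzw : ∀ i, ∀ t ≥ T, |x i t - y i t| ≤ aU i * dv i * (S.invDist x y i t / dv i) := by
    intro i t ht
    rw [mul_assoc, mul_div_cancel₀ _ (hdv i).ne']
    exact invDist_bounds hreg h2 i (hT0.le.trans ht)
  have hdecay := fun i t (ht : t ≥ T) Q r δ hr hδ hδQ hQ hrw =>
    eventually_invDist_le (Q := Q) (r := r) (δ := δ) hreg h2 h3 h5 h6 hdv hT0 hε
      (fun t ht => (hT t ht).1) hcoup hxc hyc (fun i t ht => hxd i t (hT t ht).2.1)
      (fun i t ht => hyd i t (hT t ht).2.2) i ht hr hδ hδQ hQ hrw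
  obtain ⟨K, hK0, hK⟩ := exists_forall_abs_le_of_decay (z := fun i t => x i t - y i t)
    (Inp := S.InputBound x y (fun j => aU j * dv j) ξ Ξ) hN hε hs₀ hw hzw hdecay
    (fun t ht Q hQ h => inputBound_of_forall_le hreg h6 hN hxc hyc (hT0.le.trans ht) hQ
      (hbx t) (hby t) h)
    (fun i => by
      obtain ⟨Cx, hCx⟩ := hbx T i
      obtain ⟨Cy, hCy⟩ := hby T i
      exact ⟨Cx + Cy, fun s hs => (abs_sub _ _).trans (add_le_add (hCx s hs) (hCy s hs))⟩)
  have hlim := tendsto_zero_of_decay (z := fun i t => x i t - y i t) hN hε hs₀ hw hzw hdecay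
    hK0 hK (fun B hB e he h => eventually_inputBound hreg h4 h6 hN hxc hyc hbx hby hK hB he h)
  have hsup := Tendsto.finset_sup'_nhds_apply (s := Finset.univ) Finset.univ_nonempty
    fun i _ => (hlim i).abs
  simpa using hsup
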